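/- arXiv:2005.05505 — 2 statements merged into one kernel-verified Lean document; each statement's English description precedes it below -/
import Mathlib

section
/- Every two-birds formula is minimally avoidable. The two-birds formula on variables A_1,...,A_n (n ≥ 2) has the two fragments A_1 A_2 ... A_{n-1} A_n A_{n-1} ... A_2 A_1 and A_n A_{n-1} ... A_2 A_1 A_2 ... A_{n-1} A_n; splitting either fragment yields an unavoidable formula. -/
/-- The finite factor of the infinite word `w` starting at position `i` of length `n`. -/
def extract {α : Type*} (w : ℕ → α) (i n : ℕ) : List α :=
  (List.range n).map (fun k => w (i + k))

/-- `u` is a (finite) factor of the infinite word `w`. -/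
def IsFactorOf {α : Type*} (u : List α) (w : ℕ → α) : Prop :=
  ∃ i, u = extract w i u.length

/-- A morphism (given on variables/letters) is non-erasing. -/
def NonErasing {V α : Type*} (h : V → List α) : Prop := ∀ v, h v ≠ []

/-- The image of a pattern `p` under the morphism induced by `h`. -/
def patImage {V α : Type*} (h : V → List α) (p : List V) : List α :=
  (p.map h).flatten

/-- `h` is an occurrence of the formula `f` (a set of fragments) in the infinite word `w`:
`h` is non-erasing and the `h`-image of every fragment of `f` is a factor of `w`. -/
def OccursIn {V α : Type*} (f : Set (List V)) (h : V → List α) (w : ℕ → α) : Prop :=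
  NonErasing h ∧ ∀ p ∈ f, IsFactorOf (patImage h p) w

/-- The infinite word `w` avoids the formula `f`. -/
def Avoids {V α : Type*} (w : ℕ → α) (f : Set (List V)) : Prop :=
  ∀ h : V → List α, ¬ OccursIn f h w

/-- An infinite word is recurrent if every factor occurs infinitely often. -/
def Recurrent {α : Type*} (w : ℕ → α) : Prop :=
  ∀ u : List α, IsFactorOf u w → ∀ N, ∃ i ≥ N, u = extract w i u.length

/-- An infinite word is square-free if it has no factor `uu` with `u` nonempty. -/
def SquareFree {α : Type*} (w : ℕ → α) : Prop :=
  ∀ u : List α, u ≠ [] → ¬ IsFactorOf (u ++ u) w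

/-- The formula `f'` divides the formula `f`: some non-erasing morphism maps every
fragment of `f'` to a factor of some fragment of `f`. -/
def Divides {V' V : Type*} (f' : Set (List V')) (f : Set (List V)) : Prop :=
  ∃ h : V' → List V, NonErasing h ∧ ∀ q ∈ f', ∃ p ∈ f, patImage h q <:+: p

/-- The avoidability index of a formula: the least alphabet size over which there is an
infinite word avoiding it. -/
noncomputable def lamIdx {V : Type*} (f : Set (List V)) : ℕ :=
  sInf {n : ℕ | ∃ w : ℕ → Fin n, Avoids w f}

/-- A formula is avoidable if some infinite word over some finite alphabet avoids it. -/
def Avoidable {V : Type*} (f : Set (List V)) : Prop :=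
  ∃ (n : ℕ) (w : ℕ → Fin n), Avoids w f

/-- An infinite word is `r`-free: every factor of the form `x ++ y ++ x` with `x ≠ []`
(a repetition of period `|xy|` and exponent `|xyx|/|xy|`) has exponent `< r`. -/
def AlphaFree {α : Type*} (w : ℕ → α) (r : ℝ) : Prop :=
  ∀ x y : List α, x ≠ [] → IsFactorOf (x ++ y ++ x) w →
    ((2 * x.length + y.length : ℝ) / (x.length + y.length)) < r

/-- An infinite word is `r⁺`-free: every such repetition has exponent `≤ r`. -/
def AlphaPlusFree {α : Type*} (w : ℕ → α) (r : ℝ) : Prop :=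
  ∀ x y : List α, x ≠ [] → IsFactorOf (x ++ y ++ x) w →
    ((2 * x.length + y.length : ℝ) / (x.length + y.length)) ≤ r

/-- A finite word is `r⁺`-free. -/
def AlphaPlusFreeList {α : Type*} (u : List α) (r : ℝ) : Prop :=
  ∀ x y : List α, x ≠ [] → (x ++ y ++ x) <:+: u →
    ((2 * x.length + y.length : ℝ) / (x.length + y.length)) ≤ r

/-- The first fragment A₁A₂⋯Aₙ₋₁AₙAₙ₋₁⋯A₂A₁ of the two-birds formula on n variables. -/
def frag1 (n : ℕ) : List (Fin n) := List.finRange n ++ (List.finRange n).reverse.tail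

/-- The second fragment AₙAₙ₋₁⋯A₂A₁A₂⋯Aₙ₋₁Aₙ of the two-birds formula on n variables. -/
def frag2 (n : ℕ) : List (Fin n) := (List.finRange n).reverse ++ (List.finRange n).tail

theorem extract_length {α : Type*} (w : ℕ → α) (i n : ℕ) : (extract w i n).length = n := by
  simp [extract]

theorem extract_append {α : Type*} (w : ℕ → α) (i m n : ℕ) :
    extract w i (m + n) = extract w i m ++ extract w (i + m) n := by
  simp [extract, List.range_add, Nat.add_assoc]

theorem eq_extract_append {α : Type*} (w : ℕ → α) (i : ℕ) (x y : List α) :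
    x ++ y = extract w i (x ++ y).length ↔
      x = extract w i x.length ∧ y = extract w (i + x.length) y.length := by
  rw [List.length_append, extract_append]
  constructor
  · intro h
    exact List.append_inj h (by simp [extract_length])
  · rintro ⟨h1, h2⟩
    rw [← h1, ← h2]

theorem factor_mid {α : Type*} {w : ℕ → α} {x v y : List α} (h : IsFactorOf (x ++ v ++ y) w) :
    IsFactorOf v w := by
  obtain ⟨i, hi⟩ := h
  rw [eq_extract_append, eq_extract_append] at hi
  exact ⟨_, hi.1.2⟩

theorem factor_infix {α : Type*} {w : ℕ → α} {v u : List α} (h : IsFactorOf u w)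
    (hv : v <:+: u) : IsFactorOf v w := by
  obtain ⟨x, y, rfl⟩ := hv
  exact factor_mid h

theorem patImage_append {V α : Type*} (h : V → List α) (p q : List V) :
    patImage h (p ++ q) = patImage h p ++ patImage h q := by
  simp [patImage]

theorem patImage_cons {V α : Type*} (h : V → List α) (a : V) (q : List V) :
    patImage h (a :: q) = h a ++ patImage h q := by
  simp [patImage]

theorem patImage_nil {V α : Type*} (h : V → List α) : patImage h [] = [] := by
  simp [patImage]

theorem patImage_comp {U V α : Type*} (h : V → List α) (g : U → List V) (p : List U) :
    patImage h (patImage g p) = patImage (fun v => patImage h (g v)) p := by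
  induction p with
  | nil => simp [patImage_nil]
  | cons a p ih => rw [patImage_cons, patImage_append, ih, patImage_cons]

theorem patImage_map {U V α : Type*} (h : V → List α) (g : U → V) (p : List U) :
    patImage h (p.map g) = patImage (fun v => h (g v)) p := by
  simp [patImage, Function.comp_def]

/-- Zimin words over `ℕ`. -/
def zimin : ℕ → List ℕ
  | 0 => []
  | k + 1 => zimin k ++ [k] ++ zimin k

theorem zimin_lt (k : ℕ) : ∀ x ∈ zimin k, x < k := by
  induction k with
  | zero => simp [zimin]
  | succ k ih =>
    intro x hx
    simp only [zimin, List.mem_append, List.mem_singleton] at hx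
    rcases hx with (hx | hx) | hx
    · have := ih x hx; omega
    · omega
    · have := ih x hx; omega

theorem zimin_reverse (k : ℕ) : (zimin k).reverse = zimin k := by
  induction k with
  | zero => simp [zimin]
  | succ k ih => simp [zimin, ih]

theorem zimin_length (k : ℕ) : k ≤ (zimin k).length := by
  induction k with
  | zero => simp
  | succ k ih => simp [zimin]; omega

theorem zimin_unavoidable (N k : ℕ) : ∃ l : ℕ, ∀ w : ℕ → Fin N, ∃ h : ℕ → List (Fin N),
    NonErasing h ∧ ∃ p, p + (patImage h (zimin k)).length ≤ l ∧
      patImage h (zimin k) = extract w p (patImage h (zimin k)).length := by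
  induction k with
  | zero =>
    refine ⟨0, fun w => ⟨fun _ => [w 0], fun _ => by simp, 0, ?_, ?_⟩⟩
    · simp [zimin, patImage]
    · simp [zimin, patImage, extract]
  | succ k ih =>
    obtain ⟨l, hl⟩ := ih
    refine ⟨(N ^ l + 1) * (l + 1), fun w => ?_⟩
    obtain ⟨j1, j2, hne, hj⟩ := Fintype.exists_ne_map_eq_of_card_lt
      (fun (j : Fin (N ^ l + 1)) (t : Fin l) => w (j.1 * (l + 1) + t.1)) (by simp)
    have key : ∀ j1 j2 : Fin (N ^ l + 1), j1 < j2 →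
        ((fun (t : Fin l) => w (j1.1 * (l + 1) + t.1)) =
          fun (t : Fin l) => w (j2.1 * (l + 1) + t.1)) →
        ∃ h : ℕ → List (Fin N), NonErasing h ∧ ∃ p,
          p + (patImage h (zimin (k + 1))).length ≤ (N ^ l + 1) * (l + 1) ∧
          patImage h (zimin (k + 1)) = extract w p (patImage h (zimin (k + 1))).length := by
      clear hj hne j1 j2
      intro j1 j2 hlt hj
      obtain ⟨h, hh, p, hp, hext⟩ := hl (fun t => w (j1.1 * (l + 1) + t))
      set im := patImage h (zimin k) with him
      have h1 : im = extract w (j1.1 * (l + 1) + p) im.length := by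
        conv_lhs => rw [hext]
        simp [extract, Nat.add_assoc]
      have h2 : im = extract w (j2.1 * (l + 1) + p) im.length := by
        conv_lhs => rw [h1]
        unfold extract
        apply List.map_congr_left
        intro t ht
        rw [List.mem_range] at ht
        have := congrFun hj ⟨p + t, by omega⟩
        simpa [Nat.add_assoc] using this
      have hmul : (j1.1 + 1) * (l + 1) ≤ j2.1 * (l + 1) := Nat.mul_le_mul_right _ hlt
      have hmul2 : (j2.1 + 1) * (l + 1) ≤ (N ^ l + 1) * (l + 1) := Nat.mul_le_mul_right _ j2.2
      rw [Nat.add_mul] at hmul hmul2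
      set a := j1.1 * (l + 1)
      set b := j2.1 * (l + 1)
      obtain ⟨e, he⟩ : ∃ e, b = a + im.length + (e + 1) := ⟨b - a - im.length - 1, by omega⟩
      set y := extract w (a + p + im.length) (e + 1) with hy
      have hyl : y.length = e + 1 := extract_length _ _ _
      have hup : patImage (Function.update h k y) (zimin k) = im := by
        rw [him]
        unfold patImage
        congr 1
        apply List.map_congr_left
        intro x hx
        have := zimin_lt k x hx
        rw [Function.update_of_ne (by omega)]
      have hnew : patImage (Function.update h k y) (zimin (k + 1)) = im ++ y ++ im := by
        rw [zimin, patImage_append, patImage_append, hup, patImage_cons, patImage_nil]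
        simp
      refine ⟨Function.update h k y, ?_, a + p, ?_, ?_⟩
      · intro v
        by_cases hv : v = k
        · subst hv
          rw [Function.update_self]
          intro h0
          rw [h0] at hyl
          simp at hyl
        · rw [Function.update_of_ne hv]
          exact hh v
      · rw [hnew]
        simp only [List.length_append, hyl]
        omega
      · rw [hnew, eq_extract_append, eq_extract_append]
        refine ⟨⟨h1, ?_⟩, ?_⟩
        · rw [hyl]
        · rw [List.length_append, hyl]
          have : a + p + (im.length + (e + 1)) = b + p := by omega
          rw [this]
          exact h2
    rcases lt_or_gt_of_ne hne with hlt | hlt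
    · exact key j1 j2 hlt hj
    · exact key j2 j1 hlt hj.symm

/-- The middle variables. -/
def midVars (m : ℕ) : List (Fin (m + 2)) := (List.finRange m).map (fun i => i.castSucc.succ)

theorem finRange_mid (m : ℕ) :
    List.finRange (m + 2) = 0 :: (midVars m ++ [Fin.last (m + 1)]) := by
  rw [List.finRange_succ, List.finRange_succ_last]
  simp [midVars, Function.comp_def]

theorem frag1_eq (m : ℕ) : frag1 (m + 2) =
    0 :: (midVars m ++ [Fin.last (m + 1)] ++ (midVars m).reverse ++ [0]) := by
  simp [frag1, finRange_mid]

theorem frag2_eq (m : ℕ) : frag2 (m + 2) =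
    Fin.last (m + 1) :: ((midVars m).reverse ++ [0] ++ midVars m ++ [Fin.last (m + 1)]) := by
  simp [frag2, finRange_mid]

theorem split1_unavoidable (m N : ℕ) (w : ℕ → Fin N) : ∃ h : Fin (m + 2) → List (Fin N),
    OccursIn ({(frag1 (m + 2)).dropLast, (frag1 (m + 2)).tail, frag2 (m + 2)} :
      Set (List (Fin (m + 2)))) h w := by
  obtain ⟨u, s, hus, hs⟩ : ∃ u s : List ℕ, zimin m = u ++ s ∧ s.length = m := by
    refine ⟨(zimin m).take ((zimin m).length - m), (zimin m).drop ((zimin m).length - m),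
      (List.take_append_drop _ _).symm, ?_⟩
    have := zimin_length m
    rw [List.length_drop]
    omega
  have hrev : zimin m = s.reverse ++ u.reverse := by
    rw [← zimin_reverse, hus, List.reverse_append]
  subst hs
  set m := s.length
  obtain ⟨l, hl⟩ := zimin_unavoidable N (m + 2)
  obtain ⟨H, hH, p, -, hp⟩ := hl w
  have hfac : IsFactorOf (patImage H (zimin (m + 2))) w := ⟨p, hp⟩
  let g : Fin (m + 2) → List ℕ :=
    Fin.cons (u.reverse ++ [m + 1] ++ u)
      (Fin.snoc (α := fun _ => List ℕ) (fun i : Fin m => [s.get i]) [m])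
  have hg0 : g 0 = u.reverse ++ [m + 1] ++ u := rfl
  have hgl : g (Fin.last (m + 1)) = [m] := by
    rw [← Fin.succ_last]
    simp only [g, Fin.cons_succ, Fin.snoc_last]
  have hgm : ∀ i : Fin m, g i.castSucc.succ = [s.get i] := by
    intro i
    simp only [g, Fin.cons_succ, Fin.snoc_castSucc]
  have hmid : patImage g (midVars m) = s := by
    unfold midVars
    rw [patImage_map]
    simp only [hgm, patImage]
    rw [← List.flatMap_def, ← List.map_eq_flatMap]
    exact List.map_get_finRange s
  have hmidr : patImage g (midVars m).reverse = s.reverse := by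
    unfold midVars
    rw [← List.map_reverse, patImage_map]
    simp only [hgm, patImage]
    rw [← List.flatMap_def, ← List.map_eq_flatMap, List.map_reverse]
    congr 1
    exact List.map_get_finRange s
  have hgne : NonErasing g := by
    intro v
    refine Fin.cases ?_ (fun i => ?_) v
    · rw [hg0]; simp
    · refine Fin.lastCases ?_ (fun j => ?_) i
      · rw [Fin.succ_last, hgl]; simp
      · rw [hgm]; simp
  have hz1 : zimin (m + 1) = u ++ s ++ [m] ++ s.reverse ++ u.reverse := by
    rw [zimin]
    nth_rewrite 2 [hrev]
    rw [hus]
    simp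
  have hz2 : zimin (m + 2) = (u ++ s ++ [m] ++ s.reverse ++ u.reverse) ++ [m + 1] ++
      (u ++ s ++ [m] ++ s.reverse ++ u.reverse) := by
    rw [zimin, hz1]
  have main : ∀ q : List (Fin (m + 2)), patImage g q <:+: zimin (m + 2) →
      IsFactorOf (patImage (fun v => patImage H (g v)) q) w := by
    rintro q ⟨x, y, hxy⟩
    rw [← patImage_comp]
    rw [← hxy, patImage_append, patImage_append] at hfac
    exact factor_mid hfac
  refine ⟨fun v => patImage H (g v), ?_, ?_⟩
  · intro v hv
    cases hgv : g v with
    | nil => exact hgne v hgv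
    | cons a t =>
      simp only [hgv, patImage_cons, List.append_eq_nil_iff] at hv
      exact hH a hv.1
  · intro q hq
    apply main
    rw [hz2]
    simp only [Set.mem_insert_iff, Set.mem_singleton_iff] at hq
    rcases hq with rfl | rfl | rfl
    · refine ⟨u ++ s ++ [m] ++ s.reverse, u.reverse, ?_⟩
      rw [frag1_eq, ← List.cons_append, List.dropLast_concat]
      simp [patImage_append, patImage_cons, patImage_nil, hmid, hmidr, hg0, hgl]
    · refine ⟨u, s ++ [m] ++ s.reverse ++ u.reverse, ?_⟩
      rw [frag1_eq, List.tail_cons]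
      simp [patImage_append, patImage_cons, patImage_nil, hmid, hmidr, hg0, hgl]
    · refine ⟨u ++ s, s.reverse ++ u.reverse, ?_⟩
      rw [frag2_eq]
      simp [patImage_append, patImage_cons, patImage_nil, hmid, hmidr, hg0, hgl]

theorem frag1_map_rev (n : ℕ) : (frag1 n).map Fin.rev = frag2 n := by
  simp [frag1, frag2, List.map_tail, List.map_reverse, ← List.finRange_reverse]

theorem frag2_map_rev (n : ℕ) : (frag2 n).map Fin.rev = frag1 n := by
  rw [← frag1_map_rev, List.map_map]
  simp [Function.comp_def]

theorem split2_unavoidable (m N : ℕ) (w : ℕ → Fin N) : ∃ h : Fin (m + 2) → List (Fin N),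
    OccursIn ({frag1 (m + 2), (frag2 (m + 2)).dropLast, (frag2 (m + 2)).tail} :
      Set (List (Fin (m + 2)))) h w := by
  obtain ⟨h, h1, h2⟩ := split1_unavoidable m N w
  refine ⟨fun v => h v.rev, fun v => h1 _, ?_⟩
  intro q hq
  rw [← patImage_map]
  apply h2
  simp only [Set.mem_insert_iff, Set.mem_singleton_iff] at hq ⊢
  rcases hq with rfl | rfl | rfl
  · right; right; exact frag1_map_rev _
  · left; rw [List.map_dropLast, frag2_map_rev]
  · right; left; rw [List.map_tail, frag2_map_rev]

/-- A word over a finite alphabet all of whose repetitions have long periods. -/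
theorem long_period_word (M : ℕ) : ∃ (N : ℕ) (w : ℕ → Fin N), ∀ i d L : ℕ, 0 < d → 0 < L →
    (∀ k < L, w (i + k) = w (i + d + k)) → 2 ^ M * L ≤ d := by
  classical
  let K := M + 2
  let f : ℕ → Fin (2 ^ K) × Fin (2 ^ K) := fun t =>
    (⟨t % 2 ^ K, Nat.mod_lt _ (by positivity)⟩,
      ⟨(t / 2 ^ (padicValNat 2 t)) % 2 ^ K, Nat.mod_lt _ (by positivity)⟩)
  let e := Fintype.equivFin (Fin (2 ^ K) × Fin (2 ^ K))
  refine ⟨_, fun t => e (f t), ?_⟩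
  intro i d L hd hL hk
  have hf : ∀ k < L, f (i + k) = f (i + d + k) := fun k h => e.injective (hk k h)
  clear hk
  obtain ⟨v, c, hc, hdv⟩ : ∃ v c, ¬ 2 ∣ c ∧ d = 2 ^ v * c :=
    Nat.exists_eq_pow_mul_and_not_dvd hd.ne' 2 (by norm_num)
  have hKd : 2 ^ K ∣ d := by
    have h0 := hf 0 hL
    have h1 := congrArg (fun z => z.1.1) h0
    simp only [f, Nat.add_zero] at h1
    have h2 : i ≡ i + d [MOD 2 ^ K] := h1
    have := (Nat.modEq_iff_dvd' (by omega)).1 h2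
    simpa using this
  have hKv : K ≤ v := by
    by_contra hlt
    push Not at hlt
    have h1 : 2 ^ (v + 1) ∣ 2 ^ v * c := hdv ▸ (pow_dvd_pow 2 hlt).trans hKd
    rw [pow_succ] at h1
    exact hc (Nat.dvd_of_mul_dvd_mul_left (by positivity) h1)
  obtain ⟨r, rfl⟩ : ∃ r, v = r + M + 2 := ⟨v - M - 2, by omega⟩
  have hcpos : 0 < c := Nat.pos_of_ne_zero (by rintro rfl; simp at hc)
  have hLlt : L < 2 * 2 ^ (r + 1) := by
    by_contra hge
    push Not at hge
    set P := 2 ^ (r + 1) with hP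
    have hPpos : 0 < P := by positivity
    -- an odd multiple of `P` in the window
    obtain ⟨q, hq, hq1, hq2⟩ : ∃ q, ¬ 2 ∣ q ∧ i ≤ P * q ∧ P * q < i + 2 * P := by
      have e1 := Nat.div_add_mod i P
      have e2 := Nat.mod_lt i hPpos
      by_cases hpar : 2 ∣ (i / P)
      · refine ⟨i / P + 1, by omega, ?_, ?_⟩ <;> rw [Nat.mul_add] <;> omega
      · by_cases hz : i % P = 0
        · exact ⟨i / P, hpar, by omega, by omega⟩
        · refine ⟨i / P + 2, by omega, ?_, ?_⟩ <;> rw [Nat.mul_add] <;> omega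
    have h0 := hf (P * q - i) (by omega)
    have h1 := congrArg (fun z => z.2.1) h0
    have e1 : i + (P * q - i) = P * q := by omega
    have e2 : i + d + (P * q - i) = P * (q + 2 ^ (M + 1) * c) := by
      have : d = P * (2 ^ (M + 1) * c) := by rw [hdv, hP]; ring
      rw [Nat.mul_add, ← this]; omega
    have val : ∀ x, ¬ 2 ∣ x → P * x / 2 ^ (padicValNat 2 (P * x)) = x := by
      intro x hx
      have hx0 : x ≠ 0 := by rintro rfl; simp at hx
      have : padicValNat 2 (P * x) = r + 1 := by
        rw [padicValNat.mul hPpos.ne' hx0, hP, padicValNat.prime_pow,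
          padicValNat.eq_zero_of_not_dvd hx]
      rw [this, ← hP, Nat.mul_div_cancel_left _ hPpos]
    have hodd : ¬ 2 ∣ q + 2 ^ (M + 1) * c := by
      have : 2 ∣ 2 ^ (M + 1) * c := Dvd.dvd.mul_right (dvd_pow_self 2 (by omega)) c
      omega
    simp only [f, e1, e2, val q hq, val _ hodd] at h1
    have h2 : q ≡ q + 2 ^ (M + 1) * c [MOD 2 ^ K] := h1
    have h3 := (Nat.modEq_iff_dvd' (by omega)).1 h2
    rw [Nat.add_sub_cancel_left] at h3
    have h4 : 2 ^ (M + 1) * 2 ∣ 2 ^ (M + 1) * c := by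
      rw [← pow_succ]; exact h3
    exact hc (Nat.dvd_of_mul_dvd_mul_left (by positivity) h4)
  calc 2 ^ M * L ≤ 2 ^ M * (2 * 2 ^ (r + 1)) := Nat.mul_le_mul_left _ hLlt.le
    _ = 2 ^ (r + M + 2) := by ring
    _ ≤ 2 ^ (r + M + 2) * c := Nat.le_mul_of_pos_right _ hcpos
    _ = d := hdv.symm

theorem patImage_length_le {V α : Type*} (h : V → List α) (L : ℕ) (hL : ∀ v, (h v).length ≤ L)
    (q : List V) : (patImage h q).length ≤ q.length * L := by
  induction q with
  | nil => simp [patImage]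
  | cons a q ih =>
    rw [patImage_cons, List.length_append, List.length_cons, Nat.add_mul]
    have := hL a
    omega

theorem no_twice {V : Type*} {N : ℕ} (w : ℕ → Fin N) (C : ℕ)
    (hw : ∀ i d L : ℕ, 0 < d → 0 < L →
      (∀ k < L, w (i + k) = w (i + d + k)) → C * L ≤ d)
    (h : V → List (Fin N)) (hh : NonErasing h) (v : V)
    (hv : ∀ x, (h x).length ≤ (h v).length) (l1 l2 : List V) (h1 : v ∈ l1) (h2 : v ∈ l2)
    (hlen : l1.length + l2.length ≤ C) : ¬ IsFactorOf (patImage h (l1 ++ l2)) w := by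
  intro hf
  obtain ⟨a, b, rfl⟩ := List.append_of_mem h1
  obtain ⟨c, e, rfl⟩ := List.append_of_mem h2
  have hf' : IsFactorOf (patImage h a ++ (h v ++ patImage h (b ++ c) ++ h v) ++ patImage h e) w := by
    simpa [patImage_append, patImage_cons] using hf
  obtain ⟨i, hi⟩ := factor_mid hf'
  rw [eq_extract_append, eq_extract_append] at hi
  obtain ⟨⟨e1, -⟩, e2⟩ := hi
  have hpos : 0 < (h v).length := List.length_pos_of_ne_nil (hh v)
  have hb := patImage_length_le h _ hv (b ++ c)
  rw [List.length_append] at e2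
  set L := (h v).length
  set D := L + (patImage h (b ++ c)).length
  have := hw i D L (by omega) hpos (by
    intro k hk
    have e3 : extract w i L = extract w (i + D) L := e1.symm.trans e2
    have := congrArg (fun z => z[k]?) e3
    simpa [extract, hk] using this)
  simp only [List.length_append, List.length_cons] at hlen hb
  have h5 : (b.length + c.length + 2) * L ≤ C * L := Nat.mul_le_mul_right _ (by omega)
  rw [Nat.add_mul] at h5
  omega

theorem two_birds_avoidable (m : ℕ) :
    Avoidable ({frag1 (m + 2), frag2 (m + 2)} : Set (List (Fin (m + 2)))) := by
  obtain ⟨N, w, hw⟩ := long_period_word (2 * (m + 2))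
  refine ⟨N, w, ?_⟩
  rintro h ⟨hh, hocc⟩
  obtain ⟨v, hv⟩ := Finite.exists_max (fun v => (h v).length)
  have hC : 2 * (m + 2) ≤ 2 ^ (2 * (m + 2)) := Nat.lt_two_pow_self.le
  by_cases h0 : v = 0
  · refine no_twice w _ hw h hh v hv (List.finRange (m + 2)) (List.finRange (m + 2)).reverse.tail
      (List.mem_finRange v) ?_ ?_ (hocc (frag1 (m + 2)) (by simp))
    · rw [finRange_mid, h0]; simp
    · simp; omega
  · refine no_twice w _ hw h hh v hv (List.finRange (m + 2)).reverse (List.finRange (m + 2)).tail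
      (by simp) ?_ ?_ (hocc (frag2 (m + 2)) (by simp))
    · have := List.mem_finRange v
      rw [finRange_mid, List.mem_cons] at this
      rw [finRange_mid]
      exact this.resolve_left h0
    · simp; omega

/-- for n ≥ 2, the two-birds formula on n variables is minimally
avoidable: it is avoidable, and splitting either fragment (replacing it by its prefix
and suffix of length one less) yields an unavoidable formula. -/
theorem stmt10 (n : ℕ) (hn : 2 ≤ n) :
    Avoidable ({frag1 n, frag2 n} : Set (List (Fin n))) ∧
    ¬ Avoidable ({(frag1 n).dropLast, (frag1 n).tail, frag2 n} : Set (List (Fin n))) ∧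
    ¬ Avoidable ({frag1 n, (frag2 n).dropLast, (frag2 n).tail} : Set (List (Fin n))) := by
  obtain ⟨m, rfl⟩ : ∃ m, n = m + 2 := ⟨n - 2, by omega⟩
  refine ⟨two_birds_avoidable m, ?_, ?_⟩
  · rintro ⟨N, w, hw⟩
    obtain ⟨h, hh⟩ := split1_unavoidable m N w
    exact hw h hh
  · rintro ⟨N, w, hw⟩
    obtain ⟨h, hh⟩ := split2_unavoidable m N w
    exact hw h hh
end

section
/- For every i ≥ 1, the fixed point b_4 of the morphism 0→01, 1→03, 2→21, 3→23 avoids the circuit formula T_i, whose fragments are A_j A_{j+1} A_j for j = 0,...,i-1 with indices modulo i. -/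
/-- The morphism m : 0→01, 1→03, 2→21, 3→23. -/
def m4 : Fin 4 → List (Fin 4) := ![[0,1],[0,3],[2,1],[2,3]]

/-- `b` is the fixed point b₄ of m starting with 0. -/
def IsB4 (b : ℕ → Fin 4) : Prop :=
  b 0 = 0 ∧ ∀ n, [b (2 * n), b (2 * n + 1)] = m4 (b n)

/-- The circuit formula T_i: fragments A_j A_{j+1} A_j for j = 0,…,i-1, indices mod i. -/
def Tformula (i : ℕ) : Set (List (Fin i)) :=
  {p | ∃ j k : Fin i, (j.val + 1) % i = k.val ∧ p = [j, k, j]}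

/-- Equality of the factors of length `a` at positions `x` and `y`. -/
def SameAt (b : ℕ → Fin 4) (x y a : ℕ) : Prop := ∀ t < a, b (x + t) = b (y + t)

lemma b4_facts (b : ℕ → Fin 4) (hb : IsB4 b) (n : ℕ) :
    (b (2 * n)).val = 2 * ((b n).val / 2) ∧ (b (2 * n + 1)).val = 1 + 2 * ((b n).val % 2) := by
  have h := hb.2 n
  generalize b n = c at h
  fin_cases c <;> simp [m4] at h <;> simp [h.1, h.2]

lemma b4_parity (b : ℕ → Fin 4) (hb : IsB4 b) (n : ℕ) : (b n).val % 2 = n % 2 := by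
  have h := b4_facts b hb (n / 2)
  rcases Nat.mod_two_eq_zero_or_one n with h0 | h0
  · have : 2 * (n / 2) = n := by omega
    rw [this] at h; omega
  · have : 2 * (n / 2) + 1 = n := by omega
    rw [this] at h; omega

lemma b4_pow (b : ℕ → Fin 4) (hb : IsB4 b) (r u : ℕ) :
    (b (2 ^ r * (2 * u + 1))).val / 2 = u % 2 := by
  induction r with
  | zero =>
    have h := (b4_facts b hb u).2
    have h2 := b4_parity b hb u
    simp only [pow_zero, one_mul]; omega
  | succ r ih =>
    have h := (b4_facts b hb (2 ^ r * (2 * u + 1))).1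
    rw [show 2 ^ (r + 1) * (2 * u + 1) = 2 * (2 ^ r * (2 * u + 1)) by ring]
    omega

/-- a shift by an odd multiple of `2^(r+1)` changes letters at positions `2^r * odd`. -/
lemma b4_flip (b : ℕ → Fin 4) (hb : IsB4 b) (r u q : ℕ) :
    b (2 ^ r * (2 * u + 1)) ≠ b (2 ^ r * (2 * u + 1) + 2 ^ (r + 1) * (2 * q + 1)) := by
  intro h
  have h1 := b4_pow b hb r u
  have h2 := b4_pow b hb r (u + 2 * q + 1)
  rw [show 2 ^ r * (2 * u + 1) + 2 ^ (r + 1) * (2 * q + 1)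
    = 2 ^ r * (2 * (u + 2 * q + 1) + 1) by ring] at h
  rw [h] at h1; omega

/-- every window of length `2^(r+1)` contains a position `2^r * odd`. -/
lemma window (r x : ℕ) : ∃ t u, t < 2 ^ (r + 1) ∧ x + t = 2 ^ r * (2 * u + 1) := by
  have hp : 0 < 2 ^ r := by positivity
  have hd := Nat.div_add_mod x (2 ^ (r + 1))
  have hl := Nat.mod_lt x (show 0 < 2 ^ (r + 1) by positivity)
  generalize x / 2 ^ (r + 1) = w at *
  generalize x % 2 ^ (r + 1) = l at *
  have h2 : 2 ^ (r + 1) = 2 * 2 ^ r := by ring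
  rw [h2] at hd hl ⊢
  by_cases hc : l ≤ 2 ^ r
  · refine ⟨2 ^ r - l, w, by omega, ?_⟩
    have : 2 ^ r * (2 * w + 1) = 2 * 2 ^ r * w + 2 ^ r := by ring
    omega
  · refine ⟨3 * 2 ^ r - l, w + 1, by omega, ?_⟩
    have : 2 ^ r * (2 * (w + 1) + 1) = 2 * 2 ^ r * w + 3 * 2 ^ r := by ring
    omega

lemma same_mod_aux (b : ℕ → Fin 4) (hb : IsB4 b) (x d a : ℕ) (h : SameAt b x (x + d) a) (K : ℕ)
    (hK : 2 ^ K ≤ 2 * a) : 2 ^ K ∣ d := by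
  induction K with
  | zero => simp
  | succ K ih =>
    have hK' : 2 ^ K ≤ a := by rw [pow_succ] at hK; omega
    obtain ⟨e, he⟩ := ih (by omega)
    rcases Nat.even_or_odd' e with ⟨q, hq | hq⟩
    · exact ⟨q, by rw [he, hq]; ring⟩
    · exfalso
      cases K with
      | zero =>
        have h0 := h 0 (by simp at hK'; omega)
        have h1 := b4_parity b hb (x + 0)
        have h2 := b4_parity b hb (x + d + 0)
        rw [h0] at h1
        simp at he
        omega
      | succ r =>
        obtain ⟨t, u, ht, hu⟩ := window r x
        have h0 := h t (by omega)
        rw [show x + d + t = x + t + d by ring, hu, he, hq] at h0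
        exact b4_flip b hb r u q h0

lemma same_mod (b : ℕ → Fin 4) (hb : IsB4 b) (x y a : ℕ) (h : SameAt b x y a) (K : ℕ)
    (hK : 2 ^ K ≤ 2 * a) : x % 2 ^ K = y % 2 ^ K := by
  rcases le_total x y with hxy | hxy
  · obtain ⟨d, rfl⟩ := Nat.exists_eq_add_of_le hxy
    obtain ⟨e, he⟩ := same_mod_aux b hb x d a h K hK
    simp [he]
  · obtain ⟨d, rfl⟩ := Nat.exists_eq_add_of_le hxy
    obtain ⟨e, he⟩ := same_mod_aux b hb y d a (fun t ht => (h t ht).symm) K hK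
    simp [he]

/-- The positional form of an occurrence of the (unrolled, reversed) circuit formula:
the `j`-th fragment `C_{j+1} C_j C_{j+1}` starts at `s j`, and `a j` is the length of `C_j`. -/
structure Occ (b : ℕ → Fin 4) (a s : ℕ → ℕ) : Prop where
  pos : ∀ j, 0 < a j
  per : ∀ j, SameAt b (s j) (s j + (a (j + 1) + a j)) (a (j + 1))
  link : ∀ j, SameAt b (s j) (s (j + 1) + a (j + 2)) (a (j + 1))

/-- The period of a fragment, and what it implies. -/
lemma period_decomp (b : ℕ → Fin 4) (hb : IsB4 b) (x d a : ℕ) (ha : 0 < a) (hd : 0 < d)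
    (h : SameAt b x (x + d) a) :
    ∃ r q, d = 2 ^ (r + 1) * (2 * q + 1) ∧ a < 2 ^ (r + 1) ∧
      ∀ t u, t < a → x + t ≠ 2 ^ r * (2 * u + 1) := by
  obtain ⟨k, e, he, hde⟩ := Nat.exists_eq_two_pow_mul_odd (n := d) (by omega)
  obtain ⟨q, rfl⟩ := he
  have hk : k ≠ 0 := by
    rintro rfl
    have := same_mod_aux b hb x d a h 1 (by omega)
    simp at hde; omega
  obtain ⟨r, rfl⟩ := Nat.exists_eq_succ_of_ne_zero hk
  have hf : ∀ t u, t < a → x + t ≠ 2 ^ r * (2 * u + 1) := by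
    intro t u ht hu
    have h0 := h t ht
    rw [show x + d + t = x + t + d by ring, hu, hde] at h0
    exact b4_flip b hb r u q h0
  refine ⟨r, q, hde, ?_, hf⟩
  by_contra hc
  obtain ⟨t, u, ht, hu⟩ := window r x
  exact hf t u (by simp at hc; omega) hu

/-- `C_j` has odd length `2c+1 < 2^k` and its centre is at a multiple of `2^k`. -/
def SymAt (a s : ℕ → ℕ) (j k : ℕ) : Prop :=
  ∃ c w, a j = 2 * c + 1 ∧ 2 * c + 1 < 2 ^ k ∧ s j + a (j + 1) + c = 2 ^ k * w

lemma ascent (b : ℕ → Fin 4) (hb : IsB4 b) (a s : ℕ → ℕ) (h : Occ b a s) (j k : ℕ)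
    (hS : SymAt a s j k) : a j < a (j + 1) ∧ ∃ k', SymAt a s (j + 1) k' := by
  obtain ⟨c, w, hc, hck, hw⟩ := hS
  have hA := h.pos (j + 1)
  obtain ⟨r, q, hd, hlt, hf⟩ := period_decomp b hb (s j) (a (j + 1) + a j) (a (j + 1)) hA
    (by omega) (h.per j)
  have hl := h.link j
  unfold SymAt
  rw [show j + 1 + 1 = j + 2 by ring]
  generalize s (j + 1) + a (j + 2) = m' at *
  generalize hAe : a (j + 1) = A at *
  generalize s j = x at *
  have h2 : 2 ^ (r + 1) = 2 * 2 ^ r := by ring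
  have hrp : 0 < 2 ^ r := by positivity
  obtain ⟨c', hc'⟩ : ∃ c', A = 2 * c' + 1 := by
    have : A + a j = 2 * (2 ^ r * (2 * q + 1)) := by rw [hd]; ring
    exact ⟨A / 2, by omega⟩
  have hhalf : c + c' + 1 = 2 ^ r * (2 * q + 1) := by
    have : A + a j = 2 * (2 ^ r * (2 * q + 1)) := by rw [hd]; ring
    omega
  have hcen : x + c' + 2 ^ r * (2 * q + 1) = 2 ^ k * w := by omega
  -- the exponent is larger than `k`
  have hrk : k ≤ r := by
    by_contra hcon
    obtain ⟨l, rfl⟩ := Nat.exists_eq_add_of_le (show r + 1 ≤ k by omega)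
    have e1 : x + c' + 2 ^ r * (2 * q + 1) = 2 ^ r * (2 * (2 ^ l * w)) := by
      rw [hcen]; ring
    have hle : 2 * q + 1 ≤ 2 * (2 ^ l * w) := by
      have : 2 ^ r * (2 * q + 1) ≤ 2 ^ r * (2 * (2 ^ l * w)) := by omega
      exact Nat.le_of_mul_le_mul_left this hrp
    obtain ⟨z, hz⟩ := Nat.exists_eq_add_of_le hle
    obtain ⟨u, hu⟩ : ∃ u, z = 2 * u + 1 := ⟨z / 2, by omega⟩
    refine hf c' u (by omega) ?_
    rw [hz, hu, Nat.mul_add (2 ^ r) (2 * q + 1) (2 * u + 1)] at e1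
    omega
  have hkr : 2 ^ k ≤ 2 ^ r := Nat.pow_le_pow_right (by norm_num) hrk
  have hq : q = 0 := by
    by_contra hq0
    have : 2 ^ r * 3 ≤ 2 ^ r * (2 * q + 1) := Nat.mul_le_mul_left _ (by omega)
    omega
  subst hq
  simp only [mul_zero, zero_add, mul_one] at hd hhalf hcen
  obtain ⟨t, u, ht, hu⟩ := window r x
  have htA : A ≤ t := by
    by_contra hcon
    exact hf t u (by omega) hu
  -- the position found is the centre of `C_j`
  have hmid : x + t = x + A + c := by
    obtain ⟨l, rfl⟩ := Nat.exists_eq_add_of_le hrk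
    have e1 : x + t = 2 ^ k * (2 ^ l * (2 * u + 1)) := by rw [hu]; ring
    generalize 2 ^ l * (2 * u + 1) = v at e1
    have hvw : v = w := by
      rcases lt_trichotomy v w with h1 | h1 | h1
      · have : 2 ^ k * (v + 1) ≤ 2 ^ k * w := Nat.mul_le_mul_left _ h1
        rw [mul_add] at this; omega
      · exact h1
      · have : 2 ^ k * (w + 1) ≤ 2 ^ k * v := Nat.mul_le_mul_left _ h1
        rw [mul_add] at this; omega
    rw [e1, hw, hvw]
  have hcx : x + c' = 2 ^ (r + 1) * u := by
    have e1 : 2 ^ r * (2 * u + 1) = 2 ^ (r + 1) * u + 2 ^ r := by ring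
    omega
  have hmod := same_mod b hb x m' A hl (r + 1) (by omega)
  refine ⟨by omega, r + 1, c', (m' + c') / 2 ^ (r + 1), hc', by omega, ?_⟩
  have : (m' + c') % 2 ^ (r + 1) = 0 := by
    rw [Nat.add_mod, ← hmod, ← Nat.add_mod, hcx]; simp
  exact (Nat.mul_div_cancel' (Nat.dvd_of_mod_eq_zero this)).symm

lemma no_sym (b : ℕ → Fin 4) (hb : IsB4 b) (a s : ℕ → ℕ) (h : Occ b a s) (N : ℕ)
    (hN : ∀ j, a j ≤ N) (j k : ℕ) (hS : SymAt a s j k) : False := by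
  have key : ∀ n, n ≤ a (j + n) ∧ ∃ k', SymAt a s (j + n) k' := by
    intro n
    induction n with
    | zero => exact ⟨Nat.zero_le _, k, hS⟩
    | succ n ih =>
      obtain ⟨h1, k', hk'⟩ := ih
      have := ascent b hb a s h (j + n) k' hk'
      rw [← add_assoc]
      exact ⟨by omega, this.2⟩
  have := (key (N + 1)).1
  have := hN (j + (N + 1))
  omega

lemma no_one (b : ℕ → Fin 4) (hb : IsB4 b) (a s : ℕ → ℕ) (h : Occ b a s) (N : ℕ)
    (hN : ∀ j, a j ≤ N) (j : ℕ) (hj : a j = 1) : False := by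
  rcases Nat.mod_two_eq_zero_or_one (s j + a (j + 1)) with hp | hp
  · exact no_sym b hb a s h N hN j 1 ⟨0, (s j + a (j + 1)) / 2, by omega, by norm_num, by omega⟩
  · have hA := h.pos (j + 1)
    obtain ⟨r, q, hd, hlt, hf⟩ := period_decomp b hb (s j) (a (j + 1) + a j) (a (j + 1)) hA
      (by omega) (h.per j)
    have hl := same_mod b hb _ _ _ (h.link j) 1 (by omega)
    have hq : q = 0 := by
      by_contra hq0
      have : 2 ^ (r + 1) * 3 ≤ 2 ^ (r + 1) * (2 * q + 1) := Nat.mul_le_mul_left _ (by omega)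
      omega
    subst hq
    obtain ⟨t, u, ht, hu⟩ := window r (s j)
    have htA : a (j + 1) ≤ t := by
      by_contra hcon
      exact hf t u (by omega) hu
    have hr : r = 0 := by
      by_contra hr0
      obtain ⟨r', rfl⟩ := Nat.exists_eq_succ_of_ne_zero hr0
      have : 2 ^ (r' + 1) * (2 * u + 1) = 2 * (2 ^ r' * (2 * u + 1)) := by ring
      simp only [Nat.succ_eq_add_one] at *
      omega
    subst hr
    simp at hd
    refine no_sym b hb a s h N hN (j + 1) 1
      ⟨0, (s (j + 1) + a (j + 2)) / 2, by omega, by norm_num, ?_⟩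
    rw [show j + 1 + 1 = j + 2 by ring]
    omega

lemma halve (b : ℕ → Fin 4) (hb : IsB4 b) (x y a : ℕ) (ha : 2 ≤ a) (h : SameAt b x y a) :
    x % 4 = y % 4 ∧ SameAt b ((x + 1) / 2) ((y + 1) / 2) ((x + a + 1) / 2 - (x + 1) / 2) := by
  have hm := same_mod b hb x y a h 2 (by omega)
  norm_num at hm
  refine ⟨hm, fun t ht => ?_⟩
  have h0 := h (2 * ((x + 1) / 2 + t) - x) (by omega)
  rw [show x + (2 * ((x + 1) / 2 + t) - x) = 2 * ((x + 1) / 2 + t) by omega,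
    show y + (2 * ((x + 1) / 2 + t) - x) = 2 * ((y + 1) / 2 + t) by omega] at h0
  have e1 := (b4_facts b hb ((x + 1) / 2 + t)).1
  have e2 := (b4_facts b hb ((y + 1) / 2 + t)).1
  have p1 := b4_parity b hb ((x + 1) / 2 + t)
  have p2 := b4_parity b hb ((y + 1) / 2 + t)
  rw [h0] at e1
  apply Fin.ext
  omega

lemma no_occ (b : ℕ → Fin 4) (hb : IsB4 b) (N : ℕ) :
    ∀ a s : ℕ → ℕ, Occ b a s → (∀ j, a j ≤ N) → False := by
  induction N with
  | zero =>
    intro a s h hN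
    have := h.pos 0
    have := hN 0
    omega
  | succ N ih =>
    intro a s h hN
    have h2 : ∀ j, 2 ≤ a j := by
      intro j
      by_contra hc
      have := h.pos j
      exact no_one b hb a s h (N + 1) hN j (by omega)
    have H1 := fun j => halve b hb _ _ _ (h2 (j + 1)) (h.per j)
    have H2 := fun j => halve b hb _ _ _ (h2 (j + 1)) (h.link j)
    refine ih (fun j => (s j + a (j + 1) + a j + 1) / 2 - (s j + a (j + 1) + 1) / 2)
      (fun j => (s j + 1) / 2) ⟨?_, ?_, ?_⟩ ?_
    · intro j
      have := h2 j
      show 0 < _ - _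
      omega
    · intro j
      have q1 := (H1 j).1
      obtain ⟨q2, q3⟩ := H2 j
      have q4 := (H1 j).2
      simp only [show j + 1 + 1 = j + 2 by ring]
      convert q4 using 1 <;> omega
    · intro j
      have q1 := (H2 (j + 1)).1
      obtain ⟨q2, q3⟩ := H2 j
      simp only [show j + 1 + 1 = j + 2 by ring, show j + 2 + 1 = j + 3 by ring,
        show j + 1 + 2 = j + 3 by ring] at *
      convert q3 using 1 <;> omega
    · intro j
      have := h2 j
      have := hN j
      show _ - _ ≤ _
      omega

lemma factor_get {b : ℕ → Fin 4} {u : List (Fin 4)} {x : ℕ} (h : u = extract b x u.length)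
    (t : ℕ) (ht : t < u.length) : u[t] = b (x + t) := by
  have : u[t]? = (extract b x u.length)[t]? := by rw [← h]
  simpa [extract, ht] using this

/-- for every i ≥ 1, the fixed point b₄ of 0→01, 1→03, 2→21, 3→23
avoids the circuit formula T_i. -/
theorem stmt14 (b : ℕ → Fin 4) (hb : IsB4 b) (i : ℕ) (hi : 1 ≤ i) :
    Avoids b (Tformula i) := by
  rintro h ⟨hne, hocc⟩
  let v : ℕ → Fin i := fun j => ⟨i - 1 - j % i, by omega⟩
  have hv : ∀ j, ((v (j + 1)).val + 1) % i = (v j).val := by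
    intro j
    have hl := Nat.mod_lt j hi
    show (i - 1 - (j + 1) % i + 1) % i = i - 1 - j % i
    by_cases hc : j % i + 1 = i
    · have : (j + 1) % i = 0 := by rw [← Nat.mod_add_mod, hc, Nat.mod_self]
      rw [this, show i - 1 - 0 + 1 = i by omega, Nat.mod_self]
      omega
    · have : (j + 1) % i = j % i + 1 := by
        rw [← Nat.mod_add_mod, Nat.mod_eq_of_lt (by omega)]
      rw [this, Nat.mod_eq_of_lt (by omega)]
      omega
  have hfr : ∀ j, ∃ x, ∀ t (ht : t < (h (v (j+1)) ++ (h (v j) ++ h (v (j+1)))).length),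
      (h (v (j+1)) ++ (h (v j) ++ h (v (j+1))))[t] = b (x + t) := by
    intro j
    obtain ⟨x, hx⟩ := hocc [v (j + 1), v j, v (j + 1)] ⟨v (j + 1), v j, hv j, rfl⟩
    have e : patImage h [v (j + 1), v j, v (j + 1)]
      = h (v (j+1)) ++ (h (v j) ++ h (v (j+1))) := by simp [patImage]
    rw [e] at hx
    exact ⟨x, fun t ht => factor_get hx t ht⟩
  choose s hs using hfr
  have f1 : ∀ j t (ht : t < (h (v (j+1))).length), (h (v (j+1)))[t] = b (s j + t) := by
    intro j t ht
    rw [← hs j t (by simp; omega), List.getElem_append_left ht]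
  have f2 : ∀ j t (ht : t < (h (v j)).length),
      (h (v j))[t] = b (s j + (h (v (j+1))).length + t) := by
    intro j t ht
    rw [add_assoc, ← hs j _ (by simp; omega), List.getElem_append_right (by omega),
      List.getElem_append_left (by omega)]
    simp
  have f3 : ∀ j t (ht : t < (h (v (j+1))).length),
      (h (v (j+1)))[t] = b (s j + ((h (v (j+1))).length + (h (v j)).length) + t) := by
    intro j t ht
    rw [add_assoc, ← hs j _ (by simp; omega), List.getElem_append_right (by omega),
      List.getElem_append_right (by omega)]
    congr 1
    omega
  refine no_occ b hb (∑ x : Fin i, (h x).length) (fun j => (h (v j)).length) s ⟨?_, ?_, ?_⟩ ?_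
  · intro j
    exact List.length_pos_iff.mpr (hne _)
  · intro j t ht
    rw [← f1 j t ht, ← f3 j t ht]
  · intro j t ht
    rw [← f1 j t ht, f2 (j + 1) t ht]
  · intro j
    exact Finset.single_le_sum (f := fun x => (h x).length) (fun _ _ => Nat.zero_le _)
      (Finset.mem_univ _)
end
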